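/- Let E₀ = [−π/2,π/2]² with A₀ = 2I₂, and for j = 1,…,6 let E_j = C̄_j (the six closed trapezoid pairs of the frequency ring) with A_j = Q, the matrix with rows (2,2) and (−2,2). For j ∈ {0,…,6} and n ∈ ℤ² define h_{j,n} ∈ L²([−π,π]²) by h_{j,n}(ξ) = (2π)^{−1} |det A_j|^{1/2} e^{i (A_j n)·ξ} 𝟙_{E_j}(ξ). Then the family {h_{j,n} : 0 ≤ j ≤ 6, n ∈ ℤ²} is an orthonormal basis of L²([−π,π]²). (This is the frequency-domain formulation of the fact that the Shannon-type quasi-shearlet system, whose filters are the indicator functions M₀ = 𝟙_{S₁}, M_j = 𝟙_{C_j}, generates an orthonormal basis at one level of decomposition.) -/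

import Mathlib

open scoped Real Matrix
open MeasureTheory

/-- The closed frequency ring `R = [−π,π]² \ (−π/2,π/2)²`. -/
def freqRing : Set (Fin 2 → ℝ) :=
  {ξ | (|ξ 0| ≤ π ∧ |ξ 1| ≤ π) ∧ (π / 2 ≤ |ξ 0| ∨ π / 2 ≤ |ξ 1|)}

/-- `E₀ = [−π/2,π/2]²` and the six closed trapezoid pairs `E₁ = C̄₁, …, E₆ = C̄₆` of
the frequency ring, cut by the lines through the origin of slopes `±1, ±3, ±1/3`. -/
def trapPair : Fin 7 → Set (Fin 2 → ℝ) :=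
  ![{ξ | |ξ 0| ≤ π / 2 ∧ |ξ 1| ≤ π / 2},
    {ξ ∈ freqRing | |ξ 1| ≤ |ξ 0| ∧ |ξ 0| ≤ 3 * |ξ 1| ∧ ξ 0 * ξ 1 ≤ 0},
    {ξ ∈ freqRing | 3 * |ξ 1| ≤ |ξ 0|},
    {ξ ∈ freqRing | |ξ 1| ≤ |ξ 0| ∧ |ξ 0| ≤ 3 * |ξ 1| ∧ 0 ≤ ξ 0 * ξ 1},
    {ξ ∈ freqRing | |ξ 0| ≤ |ξ 1| ∧ |ξ 1| ≤ 3 * |ξ 0| ∧ ξ 0 * ξ 1 ≤ 0},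
    {ξ ∈ freqRing | 3 * |ξ 0| ≤ |ξ 1|},
    {ξ ∈ freqRing | |ξ 0| ≤ |ξ 1| ∧ |ξ 1| ≤ 3 * |ξ 0| ∧ 0 ≤ ξ 0 * ξ 1}]


namespace QS

open scoped Pointwise

noncomputable local instance instMeasureSpaceCircle : MeasureSpace UnitAddCircle := ⟨AddCircle.haarAddCircle⟩

local instance instHaarCircle : Measure.IsAddHaarMeasure (volume : Measure UnitAddCircle) :=
  inferInstanceAs (Measure.IsAddHaarMeasure AddCircle.haarAddCircle)

local instance instProbCircle : IsProbabilityMeasure (volume : Measure UnitAddCircle) :=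
  inferInstanceAs (IsProbabilityMeasure AddCircle.haarAddCircle)

abbrev V2 := Fin 2 → ℝ

/-- The group of translations which become integral after applying `L`. -/
def latt (L : V2 →ₗ[ℝ] V2) : AddSubgroup V2 where
  carrier := {ξ | ∃ n : Fin 2 → ℤ, L ξ = fun i => (n i : ℝ)}
  zero_mem' := ⟨0, by ext i; simp⟩
  add_mem' := by
    rintro a b ⟨n, hn⟩ ⟨m, hm⟩
    exact ⟨n + m, by ext i; simp [hn, hm]⟩
  neg_mem' := by
    rintro a ⟨n, hn⟩
    exact ⟨-n, by ext i; simp [hn]⟩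

lemma latt_countable (L : V2 →ₗ[ℝ] V2) (hL : Function.Injective L) : Countable (latt L) := by
  choose f hf using fun g : latt L => g.2
  refine Function.Injective.countable (f := f) ?_
  intro a b hab
  apply Subtype.ext
  apply hL
  rw [hf a, hf b, hab]

/-- the projection to the torus -/
def proj (L : V2 →ₗ[ℝ] V2) : V2 → UnitAddTorus (Fin 2) := fun ξ i => ((L ξ i : ℝ) : UnitAddCircle)

lemma measurable_mkT : Measurable (fun (x : V2) => (fun i => (x i : UnitAddCircle) : UnitAddTorus (Fin 2))) :=
  measurable_pi_lambda _ (fun i => AddCircle.measurable_mk'.comp (measurable_pi_apply i))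

lemma measurable_proj (L : V2 →ₗ[ℝ] V2) : Measurable (proj L) :=
  measurable_mkT.comp (LinearMap.continuous_of_finiteDimensional L).measurable

def box : Set V2 := {x | ∀ i, x i ∈ Set.Ioc (0:ℝ) (0 + 1)}

lemma measurableSet_box : MeasurableSet box := by
  have : box = Set.pi Set.univ (fun _ => Set.Ioc (0:ℝ) (0+1)) := by ext; simp [box]
  rw [this]
  exact MeasurableSet.univ_pi fun i => measurableSet_Ioc

lemma fd_box (L : V2 →ₗ[ℝ] V2) (hL : Function.Bijective L) :
    IsAddFundamentalDomain (latt L) (L ⁻¹' box) volume := by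
  refine IsAddFundamentalDomain.mk' ?_ ?_
  · exact (measurableSet_box.preimage
      (LinearMap.continuous_of_finiteDimensional L).measurable).nullMeasurableSet
  · intro ξ
    have key := fun i => existsUnique_add_zsmul_mem_Ioc (zero_lt_one (α := ℝ)) (L ξ i) 0
    choose n hn hu using key
    obtain ⟨g, hg⟩ := hL.2 (fun i => (n i : ℝ))
    refine ⟨⟨g, n, hg⟩, ?_, ?_⟩
    · intro i
      have := hn i
      simp only [zsmul_eq_mul, mul_one] at this
      change L (g + ξ) i ∈ _
      rw [map_add, Pi.add_apply, hg]
      rwa [add_comm (L ξ i)] at this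
    · rintro ⟨g', m, hm⟩ h'
      apply Subtype.ext
      apply hL.1
      rw [hm]
      simp only
      rw [hg]
      ext i
      have h1 : L (g' + ξ) i ∈ _ := h' i
      rw [map_add, Pi.add_apply, hm] at h1
      have := hu i (m i) (by simp only [zsmul_eq_mul, mul_one]; rwa [add_comm (L ξ i)])
      rw [this]

/-- data saying that `E` tiles the plane -/
structure Tiles (L : V2 →ₗ[ℝ] V2) (E U : Set V2) : Prop where
  bij : Function.Bijective L
  det : LinearMap.det L ≠ 0
  mE : MeasurableSet E
  mU : MeasurableSet U
  sub : U ⊆ E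
  null : volume (E \ U) = 0
  cover : ∀ ξ, ∃ ξ' ∈ E, ∃ n : Fin 2 → ℤ, ∀ i, L ξ' i - L ξ i = n i
  disj : ∀ ξ ∈ U, ∀ ξ' ∈ U, ∀ n : Fin 2 → ℤ, (∀ i, L ξ' i - L ξ i = n i) → ξ = ξ'

variable {L : V2 →ₗ[ℝ] V2} {E U : Set V2}

lemma Tiles.fd (t : Tiles L E U) : IsAddFundamentalDomain (latt L) E volume := by
  have hUE : U =ᵐ[volume] E := by
    refine Filter.EventuallyLE.antisymm (LE.le.eventuallyLE t.sub) ?_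
    exact ae_le_set.2 t.null
  refine ⟨t.mE.nullMeasurableSet, ?_, ?_⟩
  · refine Filter.Eventually.of_forall fun ξ => ?_
    obtain ⟨ξ', h', n, hn⟩ := t.cover ξ
    refine ⟨⟨ξ' - ξ, n, ?_⟩, ?_⟩
    · ext i; simp [hn]
    · change (ξ' - ξ) + ξ ∈ E
      simpa using h'
  · intro g g' hgg
    have hg : ∀ a : latt L, ((a +ᵥ U : Set V2)) =ᵐ[volume] (a +ᵥ E : Set V2) := fun a =>
      (vadd_set_ae_eq (μ := volume) a).2 hUE
    refine AEDisjoint.congr (Disjoint.aedisjoint ?_) (hg g).symm (hg g').symm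
    rw [Set.disjoint_left]
    rintro x ⟨u, hu, hux⟩ ⟨u', hu', hux'⟩
    apply hgg
    obtain ⟨n, hn⟩ := g.2
    obtain ⟨m, hm⟩ := g'.2
    have hx : (g : V2) + u = g' + u' := by
      have h1 : (g : V2) + u = x := hux
      have h2 : (g' : V2) + u' = x := hux'
      rw [h1, h2]
    have hLx := congrArg L hx
    have := t.disj u hu u' hu' (n - m) (fun i => by
      have h2 := congrFun hLx i
      simp only [map_add, Pi.add_apply, hn, hm] at h2
      simp only [Pi.sub_apply, Int.cast_sub]
      linarith)
    subst this
    exact Subtype.ext (add_right_cancel hx)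

lemma Tiles.mp (t : Tiles L E U) :
    MeasurePreserving (proj L) (ENNReal.ofReal |LinearMap.det L| • volume.restrict E) volume := by
  refine ⟨measurable_proj L, ?_⟩
  ext T hT
  have : Countable (latt L) := latt_countable L t.bij.1
  have hinv : ∀ g : latt L, (g +ᵥ · : V2 → V2) ⁻¹' (proj L ⁻¹' T) = proj L ⁻¹' T := by
    intro g
    ext ξ
    obtain ⟨n, hn⟩ := g.2
    have : proj L (g +ᵥ ξ) = proj L ξ := by
      funext i
      have h1 : L (g +ᵥ ξ) i = n i + L ξ i := by
        have : (g +ᵥ ξ : V2) = (g : V2) + ξ := rfl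
        rw [this, map_add, Pi.add_apply, hn]
      simp only [proj, h1]
      rw [AddCircle.coe_add]
      have : ((n i : ℝ) : UnitAddCircle) = 0 := by
        rw [AddCircle.coe_eq_zero_iff]
        exact ⟨n i, by simp⟩
      rw [this, zero_add]
    simp only [Set.mem_preimage, this]
  have h1 := t.fd.measure_set_eq (fd_box L t.bij) (measurable_proj L hT) hinv
  rw [Measure.map_apply (measurable_proj L) hT, Measure.smul_apply,
    Measure.restrict_apply (measurable_proj L hT), smul_eq_mul, h1]
  have h2 : proj L ⁻¹' T ∩ L ⁻¹' box = L ⁻¹' ((fun x : V2 => (fun i => (x i : UnitAddCircle) : UnitAddTorus (Fin 2))) ⁻¹' T ∩ box) := rfl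
  rw [h2, Measure.addHaar_preimage_linearMap _ t.det, ← mul_assoc,
    ← ENNReal.ofReal_mul (abs_nonneg _), ← abs_mul, mul_inv_cancel₀ t.det, abs_one,
    ENNReal.ofReal_one, one_mul]
  have h3 := UnitAddTorus.lintegral_preimage (d := Fin 2) (T.indicator 1) (fun _ => 0)
  rw [lintegral_indicator_one hT] at h3
  refine Eq.trans ?_ h3.symm
  rw [← Measure.restrict_apply (measurable_mkT hT), ← lintegral_indicator_one (measurable_mkT hT)]
  rfl

lemma torus_integral (n : Fin 2 → ℤ) :
    ∫ x, UnitAddTorus.mFourier n x ∂(volume : Measure (UnitAddTorus (Fin 2))) = if n = 0 then 1 else 0 := by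
  have h := orthonormal_iff_ite.mp (UnitAddTorus.orthonormal_mFourier (d := Fin 2)) 0 n
  simp only [ContinuousMap.inner_toLp, UnitAddTorus.mFourier_zero] at h
  rw [show (if n = 0 then (1:ℂ) else 0) = if 0 = n then 1 else 0 by simp [eq_comm], ← h]
  congr 1
  ext x
  simp

lemma Tiles.integral_comp (t : Tiles L E U) (g : UnitAddTorus (Fin 2) → ℂ)
    (hg : AEStronglyMeasurable g volume) :
    ∫ x, g x = (|LinearMap.det L| : ℝ) • ∫ ξ in E, g (proj L ξ) := by
  have h1 := t.mp.map_eq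
  rw [← h1, integral_map (measurable_proj L).aemeasurable (by rw [h1]; exact hg),
    integral_smul_measure, ENNReal.toReal_ofReal (abs_nonneg _)]

lemma Tiles.integral_four (t : Tiles L E U) (n : Fin 2 → ℤ) :
    ∫ ξ in E, UnitAddTorus.mFourier n (proj L ξ) = if n = 0 then ((|LinearMap.det L|⁻¹ : ℝ) : ℂ) else 0 := by
  have h := t.integral_comp (UnitAddTorus.mFourier n)
    (UnitAddTorus.mFourier n).continuous.aestronglyMeasurable
  rw [torus_integral] at h
  have hd : ((|LinearMap.det L| : ℝ) : ℂ) ≠ 0 := by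
    exact_mod_cast abs_ne_zero.2 t.det
  rw [Complex.real_smul] at h
  rw [eq_comm, mul_comm, ← eq_div_iff hd] at h
  rw [h]
  split_ifs <;> simp

lemma torus_zero (g : UnitAddTorus (Fin 2) → ℂ) (hg : MemLp g 2 volume)
    (h : ∀ n : Fin 2 → ℤ, ∫ x, starRingEnd ℂ (UnitAddTorus.mFourier n x) * g x = 0) : g =ᵐ[volume] 0 := by
  have htop := UnitAddTorus.span_mFourierLp_closure_eq_top (d := Fin 2) (p := 2) (by simp)
  rw [Submodule.topologicalClosure_eq_top_iff] at htop
  have : hg.toLp g ∈ (Submodule.span ℂ (Set.range (UnitAddTorus.mFourierLp (d := Fin 2) 2)))ᗮ := by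
    rw [Submodule.mem_orthogonal]
    intro u hu
    induction hu using Submodule.span_induction with
    | mem x hx =>
      obtain ⟨n, rfl⟩ := hx
      rw [L2.inner_def, ← h n]
      apply integral_congr_ae
      filter_upwards [hg.coeFn_toLp, UnitAddTorus.coeFn_mFourierLp (d := Fin 2) 2 n] with x h1 h2
      rw [h1, h2, RCLike.inner_apply, mul_comm]
    | zero => simp
    | add x y _ _ hx hy => rw [inner_add_left, hx, hy, add_zero]
    | smul a x _ hx => rw [inner_smul_left, hx, mul_zero]
  rw [htop, Submodule.mem_bot] at this
  have h2 := hg.coeFn_toLp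
  rw [this] at h2
  exact h2.symm.trans (Lp.coeFn_zero _ _ _)

lemma Tiles.zero (t : Tiles L E U) (f : V2 → ℂ) (hf : MemLp f 2 (volume.restrict E))
    (h : ∀ n : Fin 2 → ℤ, ∫ ξ in E, starRingEnd ℂ (UnitAddTorus.mFourier n (proj L ξ)) * f ξ = 0) :
    f =ᵐ[volume.restrict E] 0 := by
  set c := ENNReal.ofReal |LinearMap.det L| with hc
  have hc0 : c ≠ 0 := by
    rw [hc]; simpa using t.det
  have hct : c ≠ ⊤ := ENNReal.ofReal_ne_top
  obtain ⟨f', hf', hff'⟩ := hf.1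
  have hemb : MeasurableEmbedding (fun u : U => proj L u) := by
    have : StandardBorelSpace U := t.mU.standardBorel
    apply Measurable.measurableEmbedding
    · exact (measurable_proj L).comp measurable_subtype_coe
    · intro u v huv
      apply Subtype.ext
      have key : ∀ i, ∃ k : ℤ, L v i - L u i = k := by
        intro i
        have h1 : ((L v i : ℝ) : UnitAddCircle) = (L u i : ℝ) := (congrFun huv i).symm
        rw [← sub_eq_zero, ← AddCircle.coe_sub, AddCircle.coe_eq_zero_iff] at h1
        obtain ⟨k, hk⟩ := h1
        exact ⟨k, by rw [← hk]; simp⟩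
      choose n hn using key
      exact t.disj u u.2 v v.2 n hn
  obtain ⟨g, hg, hgf⟩ := hemb.exists_measurable_extend
    (g := fun u : U => f' u) (hf'.measurable.comp measurable_subtype_coe) (fun _ => ⟨0⟩)
  have hU : ∀ᵐ ξ ∂(volume.restrict E), ξ ∈ U := by
    rw [ae_restrict_iff' t.mE]
    have := t.null
    rw [measure_eq_zero_iff_ae_notMem] at this
    filter_upwards [this] with ξ h1 h2
    by_contra h3
    exact h1 ⟨h2, h3⟩
  have hgf2 : (fun ξ => g (proj L ξ)) =ᵐ[volume.restrict E] f := by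
    filter_upwards [hU, hff'] with ξ h1 h2
    rw [h2]
    exact congrFun hgf ⟨ξ, h1⟩
  have hgL : MemLp g 2 volume := by
    rw [← t.mp.map_eq, memLp_map_measure_iff hg.aestronglyMeasurable (measurable_proj L).aemeasurable]
    exact ((memLp_congr_ae hgf2).2 hf).smul_measure hct
  have hz := torus_zero g hgL (fun n => by
    rw [t.integral_comp (fun x => starRingEnd ℂ (UnitAddTorus.mFourier n x) * g x) ?_]
    · have : ∫ ξ in E, (starRingEnd ℂ) ((UnitAddTorus.mFourier n) (proj L ξ)) * g (proj L ξ) = 0 := by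
        rw [← h n]
        apply integral_congr_ae
        filter_upwards [hgf2] with ξ h1
        rw [h1]
      rw [this, smul_zero]
    · exact ((Complex.continuous_conj.comp (UnitAddTorus.mFourier n).continuous).measurable.mul
        hg).aestronglyMeasurable)
  have h3 := t.mp.quasiMeasurePreserving.ae_eq_comp hz
  have h4 : (g ∘ proj L) =ᵐ[volume.restrict E] ((0 : UnitAddTorus (Fin 2) → ℂ) ∘ proj L) := by
    rwa [Filter.EventuallyEq, Measure.ae_ennreal_smul_measure_eq hc0] at h3
  exact hgf2.symm.trans h4

lemma four_eq (n : Fin 2 → ℤ) (ξ : V2) : UnitAddTorus.mFourier n (proj L ξ) =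
    Complex.exp (Complex.I * ((2 * π * (n 0 * L ξ 0 + n 1 * L ξ 1) : ℝ) : ℂ)) := by
  simp only [UnitAddTorus.mFourier, ContinuousMap.coe_mk, Fin.prod_univ_two, proj, fourier_coe_apply]
  rw [← Complex.exp_add]
  congr 1
  push_cast
  ring

def Trap (k : ℤ) (x y : ℝ) : Prop :=
  (π / 2 ≤ x ∧ x ≤ π ∧ (2 * k - 1) * x ≤ 3 * y ∧ 3 * y ≤ (2 * k + 1) * x) ∨
  (π / 2 ≤ -x ∧ -x ≤ π ∧ (2 * k - 1) * (-x) ≤ -(3 * y) ∧ -(3 * y) ≤ (2 * k + 1) * (-x))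

def TrapS (k : ℤ) (x y : ℝ) : Prop :=
  (π / 2 < x ∧ x < π ∧ (2 * k - 1) * x < 3 * y ∧ 3 * y < (2 * k + 1) * x) ∨
  (π / 2 < -x ∧ -x < π ∧ (2 * k - 1) * (-x) < -(3 * y) ∧ -(3 * y) < (2 * k + 1) * (-x))

lemma trap_cover (k : ℤ) (x y : ℝ) : ∃ x' y' : ℝ, Trap k x' y' ∧ ∃ a b : ℤ,
    x' - y' - (x - y) = π * a ∧ x' + y' - (x + y) = π * b := by
  have hπ := Real.pi_pos
  obtain ⟨s, ⟨hs1, hs2⟩, -⟩ := existsUnique_add_zsmul_mem_Ico (half_pos hπ) x (π / 2)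
  simp only [zsmul_eq_mul] at hs1 hs2
  set X := x + s * (π / 2) with hX
  obtain ⟨r, ⟨hr1, hr2⟩, -⟩ := existsUnique_add_zsmul_mem_Ico hπ (y + s * (π / 2)) ((2 * k - 1) * X / 3)
  simp only [zsmul_eq_mul] at hr1 hr2
  set Y := y + s * (π / 2) + r * π with hY
  by_cases h : 3 * Y ≤ (2 * k + 1) * X
  · refine ⟨X, Y, Or.inl ⟨hs1, by linarith, by linarith, h⟩, -r, s + r, ?_, ?_⟩ <;>
    · push_cast; rw [hY, hX]; ring
  · refine ⟨X - 3 * π / 2, Y - (2 * k + 1) * (π / 2), Or.inr ⟨by linarith, by linarith, by linarith, by linarith⟩,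
      -r + k - 1, s + r - k - 2, ?_, ?_⟩ <;>
    · push_cast; rw [hY, hX]; ring

lemma int_of_pi {c : ℤ} {z : ℝ} (h : z = π * c) {l u : ℤ} (h1 : π * l < z) (h2 : z < π * u) :
    l < c ∧ c < u := by
  have hπ := Real.pi_pos
  rw [h] at h1 h2
  exact ⟨by exact_mod_cast lt_of_mul_lt_mul_left h1 hπ.le,
    by exact_mod_cast lt_of_mul_lt_mul_left h2 hπ.le⟩

lemma trap_disj (k : ℤ) (x y x' y' : ℝ) (h : TrapS k x y) (h' : TrapS k x' y') (a b : ℤ)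
    (ha : x' - y' - (x - y) = π * a) (hb : x' + y' - (x + y) = π * b) : x = x' ∧ y = y' := by
  have hπ := Real.pi_pos
  have hx : 2 * (x' - x) = π * ((a + b : ℤ) : ℝ) := by push_cast; linarith
  have hy : 2 * (y' - y) = π * ((b - a : ℤ) : ℝ) := by push_cast; linarith
  rcases h with ⟨h1, h2, h3, h4⟩ | ⟨h1, h2, h3, h4⟩ <;>
  rcases h' with ⟨g1, g2, g3, g4⟩ | ⟨g1, g2, g3, g4⟩
  · obtain ⟨u1, u2⟩ := int_of_pi hx (l := -1) (u := 1) (by push_cast; linarith) (by push_cast; linarith)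
    have e : a + b = 0 := by omega
    rw [e] at hx
    have ex : x' = x := by push_cast at hx; linarith
    subst ex
    obtain ⟨v1, v2⟩ := int_of_pi hy (l := -2) (u := 2) (by push_cast; linarith) (by push_cast; linarith)
    have e2 : b - a = 0 := by omega
    rw [e2] at hy
    exact ⟨rfl, by push_cast at hy; linarith⟩
  · exfalso
    obtain ⟨u1, u2⟩ := int_of_pi hx (l := -4) (u := -2) (by push_cast; linarith) (by push_cast; linarith)
    have e : a + b = -3 := by omega
    rw [e] at hx
    have ex : x' = x - 3 * π / 2 := by push_cast at hx; linarith
    subst ex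
    obtain ⟨v1, v2⟩ := int_of_pi hy (l := -(2 * k + 1)) (u := -(2 * k - 1))
      (by push_cast; linarith) (by push_cast; linarith)
    omega
  · exfalso
    obtain ⟨u1, u2⟩ := int_of_pi hx (l := 2) (u := 4) (by push_cast; linarith) (by push_cast; linarith)
    have e : a + b = 3 := by omega
    rw [e] at hx
    have ex : x' = x + 3 * π / 2 := by push_cast at hx; linarith
    subst ex
    obtain ⟨v1, v2⟩ := int_of_pi hy (l := (2 * k - 1)) (u := (2 * k + 1))
      (by push_cast; linarith) (by push_cast; linarith)
    omega
  · obtain ⟨u1, u2⟩ := int_of_pi hx (l := -1) (u := 1) (by push_cast; linarith) (by push_cast; linarith)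
    have e : a + b = 0 := by omega
    rw [e] at hx
    have ex : x' = x := by push_cast at hx; linarith
    subst ex
    obtain ⟨v1, v2⟩ := int_of_pi hy (l := -2) (u := 2) (by push_cast; linarith) (by push_cast; linarith)
    have e2 : b - a = 0 := by omega
    rw [e2] at hy
    exact ⟨rfl, by push_cast at hy; linarith⟩

lemma line_null (a b c : ℝ) (hab : a ≠ 0 ∨ b ≠ 0) : volume {ξ : V2 | a * ξ 0 + b * ξ 1 = c} = 0 := by
  let s : AffineSubspace ℝ V2 :=
    { carrier := {ξ : V2 | a * ξ 0 + b * ξ 1 = c}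
      smul_vsub_vadd_mem' := by
        intro t p q r hp hq hr
        simp only [Set.mem_setOf_eq] at hp hq hr ⊢
        simp only [vsub_eq_sub, vadd_eq_add, Pi.add_apply, Pi.smul_apply, Pi.sub_apply, smul_eq_mul]
        linear_combination t * hp - t * hq + hr }
  refine Measure.addHaar_affineSubspace volume s ?_
  intro hs
  have hall : ∀ ξ : V2, a * ξ 0 + b * ξ 1 = c := fun ξ => by
    have : ξ ∈ s := by rw [hs]; trivial
    exact this
  have h0 := hall ![0, 0]
  have h1 := hall ![1, 0]
  have h2 := hall ![0, 1]
  simp at h0 h1 h2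
  rcases hab with h | h
  · exact h (by linarith)
  · exact h (by linarith)

lemma line_null' (p q : Fin 2) (hpq : p ≠ q) (a b c : ℝ) (hab : a ≠ 0 ∨ b ≠ 0) :
    ∀ᵐ ξ : V2, a * ξ p + b * ξ q ≠ c := by
  have key : ∀ a b : ℝ, (a ≠ 0 ∨ b ≠ 0) → ∀ᵐ ξ : V2, a * ξ 0 + b * ξ 1 ≠ c := by
    intro a b h
    have := line_null a b c h
    rw [measure_eq_zero_iff_ae_notMem] at this
    exact this
  fin_cases p <;> fin_cases q
  · exact absurd rfl hpq
  · exact key a b hab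
  · filter_upwards [key b a hab.symm] with ξ h
    simpa [add_comm] using h
  · exact absurd rfl hpq

def ET (p q : Fin 2) (k : ℤ) : Set V2 := {ξ | Trap k (ξ p) (ξ q)}
def UT (p q : Fin 2) (k : ℤ) : Set V2 := {ξ | TrapS k (ξ p) (ξ q)}

lemma ET_null (p q : Fin 2) (hpq : p ≠ q) (k : ℤ) : volume (ET p q k \ UT p q k) = 0 := by
  rw [measure_eq_zero_iff_ae_notMem]
  filter_upwards [line_null' p q hpq 1 0 (π / 2) (by simp), line_null' p q hpq 1 0 π (by simp),
    line_null' p q hpq 1 0 (-(π / 2)) (by simp), line_null' p q hpq 1 0 (-π) (by simp),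
    line_null' p q hpq (2 * k - 1) (-3) 0 (by simp), line_null' p q hpq (2 * k + 1) (-3) 0 (by simp)]
    with ξ n1 n2 n3 n4 n5 n6
  rintro ⟨h, h'⟩
  apply h'
  rcases h with ⟨h1, h2, h3, h4⟩ | ⟨h1, h2, h3, h4⟩
  · exact Or.inl ⟨lt_of_le_of_ne h1 (fun e => n1 (by linarith)), lt_of_le_of_ne h2 (fun e => n2 (by linarith)),
      lt_of_le_of_ne h3 (fun e => n5 (by linarith)), lt_of_le_of_ne h4 (fun e => n6 (by linarith))⟩
  · exact Or.inr ⟨lt_of_le_of_ne h1 (fun e => n3 (by linarith)), lt_of_le_of_ne h2 (fun e => n4 (by linarith)),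
      lt_of_le_of_ne h3 (fun e => n5 (by linarith)), lt_of_le_of_ne h4 (fun e => n6 (by linarith))⟩

lemma ET_meas (p q : Fin 2) (k : ℤ) : MeasurableSet (ET p q k) := by
  unfold ET Trap
  measurability

lemma UT_meas (p q : Fin 2) (k : ℤ) : MeasurableSet (UT p q k) := by
  unfold UT TrapS
  measurability

lemma UT_sub (p q : Fin 2) (k : ℤ) : UT p q k ⊆ ET p q k := by
  rintro ξ (⟨h1, h2, h3, h4⟩ | ⟨h1, h2, h3, h4⟩)
  · exact Or.inl ⟨h1.le, h2.le, h3.le, h4.le⟩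
  · exact Or.inr ⟨h1.le, h2.le, h3.le, h4.le⟩

/-- The frequency map attached to the matrix `A`. -/
noncomputable def LA (A : Matrix (Fin 2) (Fin 2) ℝ) : V2 →ₗ[ℝ] V2 := Matrix.toLin' ((2 * π)⁻¹ • Aᵀ)

lemma LA_det (A : Matrix (Fin 2) (Fin 2) ℝ) : LinearMap.det (LA A) = ((2 * π)⁻¹) ^ 2 * A.det := by
  rw [LA, LinearMap.det_toLin', Matrix.det_smul, Matrix.det_transpose, Fintype.card_fin]

lemma LA_apply (A : Matrix (Fin 2) (Fin 2) ℝ) (ξ : V2) (i : Fin 2) :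
    LA A ξ i = (2 * π)⁻¹ * (A 0 i * ξ 0 + A 1 i * ξ 1) := by
  fin_cases i <;> simp [LA] <;> ring

lemma LA_det_ne {A : Matrix (Fin 2) (Fin 2) ℝ} (h : A.det ≠ 0) : LinearMap.det (LA A) ≠ 0 := by
  rw [LA_det]
  have := Real.pi_pos
  positivity

lemma LA_bij {A : Matrix (Fin 2) (Fin 2) ℝ} (h : A.det ≠ 0) : Function.Bijective (LA A) := by
  have := LA_det_ne h
  exact (LinearMap.equivOfDetNeZero _ this).bijective

def QQ : Matrix (Fin 2) (Fin 2) ℝ := Matrix.of ![![2, 2], ![-2, 2]]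

lemma QQ_det : QQ.det ≠ 0 := by
  rw [QQ, Matrix.det_fin_two]; norm_num

lemma LQ0 (ξ : V2) : LA QQ ξ 0 = (ξ 0 - ξ 1) / π := by
  rw [LA_apply]; simp [QQ]; field_simp; ring

lemma LQ1 (ξ : V2) : LA QQ ξ 1 = (ξ 0 + ξ 1) / π := by
  rw [LA_apply]; simp [QQ]; field_simp

lemma diff_div (u v : ℝ) (n : ℝ) : u / π - v / π = n ↔ u - v = π * n := by
  have := Real.pi_pos
  rw [← sub_div, div_eq_iff this.ne', mul_comm]

lemma tiles01 (k : ℤ) : Tiles (LA QQ) (ET 0 1 k) (UT 0 1 k) where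
  bij := LA_bij QQ_det
  det := LA_det_ne QQ_det
  mE := ET_meas _ _ _
  mU := UT_meas _ _ _
  sub := UT_sub _ _ _
  null := ET_null _ _ (by simp) _
  cover := by
    intro ξ
    obtain ⟨x, y, h, a, b, ha, hb⟩ := trap_cover k (ξ 0) (ξ 1)
    refine ⟨![x, y], h, ![a, b], ?_⟩
    rw [Fin.forall_fin_two]
    rw [LQ0, LQ0, LQ1, LQ1, diff_div, diff_div]
    exact ⟨ha, hb⟩
  disj := by
    intro ξ h ξ' h' n hn
    rw [Fin.forall_fin_two, LQ0, LQ0, LQ1, LQ1, diff_div, diff_div] at hn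
    obtain ⟨e1, e2⟩ := trap_disj k _ _ _ _ h h' (n 0) (n 1) hn.1 hn.2
    ext i; fin_cases i
    · exact e1
    · exact e2

lemma tiles10 (k : ℤ) : Tiles (LA QQ) (ET 1 0 k) (UT 1 0 k) where
  bij := LA_bij QQ_det
  det := LA_det_ne QQ_det
  mE := ET_meas _ _ _
  mU := UT_meas _ _ _
  sub := UT_sub _ _ _
  null := ET_null _ _ (by simp) _
  cover := by
    intro ξ
    obtain ⟨x, y, h, a, b, ha, hb⟩ := trap_cover k (ξ 1) (ξ 0)
    refine ⟨![y, x], h, ![-a, b], ?_⟩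
    rw [Fin.forall_fin_two]
    rw [LQ0, LQ0, LQ1, LQ1, diff_div, diff_div]
    simp
    constructor <;> linarith
  disj := by
    intro ξ h ξ' h' n hn
    rw [Fin.forall_fin_two, LQ0, LQ0, LQ1, LQ1, diff_div, diff_div] at hn
    obtain ⟨e1, e2⟩ := trap_disj k _ _ _ _ h h' (-n 0) (n 1) (by push_cast; linarith) (by linarith)
    ext i; fin_cases i
    · exact e2
    · exact e1

def A2 : Matrix (Fin 2) (Fin 2) ℝ := Matrix.of ![![2, 0], ![0, 2]]

lemma A2_det : A2.det ≠ 0 := by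
  rw [A2, Matrix.det_fin_two]; norm_num

lemma LA2 (ξ : V2) (i : Fin 2) : LA A2 ξ i = ξ i / π := by
  rw [LA_apply]; fin_cases i <;> simp [A2] <;> field_simp

def E0 : Set V2 := {ξ | |ξ 0| ≤ π / 2 ∧ |ξ 1| ≤ π / 2}
def U0 : Set V2 := {ξ | |ξ 0| < π / 2 ∧ |ξ 1| < π / 2}

lemma tiles0 : Tiles (LA A2) E0 U0 where
  bij := LA_bij A2_det
  det := LA_det_ne A2_det
  mE := by unfold E0; measurability
  mU := by unfold U0; measurability
  sub := fun ξ h => ⟨h.1.le, h.2.le⟩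
  null := by
    rw [measure_eq_zero_iff_ae_notMem]
    filter_upwards [line_null' 0 1 (by simp) 1 0 (π / 2) (by simp),
      line_null' 0 1 (by simp) 1 0 (-(π / 2)) (by simp),
      line_null' 0 1 (by simp) 0 1 (π / 2) (by simp),
      line_null' 0 1 (by simp) 0 1 (-(π / 2)) (by simp)] with ξ n1 n2 n3 n4
    rintro ⟨⟨h1, h2⟩, h'⟩
    apply h'
    rw [abs_le] at h1 h2
    refine ⟨abs_lt.2 ⟨?_, ?_⟩, abs_lt.2 ⟨?_, ?_⟩⟩
    · exact lt_of_le_of_ne h1.1 (fun e => n2 (by linarith))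
    · exact lt_of_le_of_ne h1.2 (fun e => n1 (by linarith))
    · exact lt_of_le_of_ne h2.1 (fun e => n4 (by linarith))
    · exact lt_of_le_of_ne h2.2 (fun e => n3 (by linarith))
  cover := by
    intro ξ
    have key := fun i => (existsUnique_add_zsmul_mem_Ico Real.pi_pos (ξ i) (-(π / 2))).exists
    choose n hn using key
    simp only [zsmul_eq_mul, Set.mem_Ico] at hn
    refine ⟨fun i => ξ i + n i * π, ⟨abs_le.2 ⟨(hn 0).1, ?_⟩, abs_le.2 ⟨(hn 1).1, ?_⟩⟩, n, ?_⟩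
    · linarith [(hn 0).2]
    · linarith [(hn 1).2]
    · intro i
      rw [LA2, LA2, diff_div]; ring
  disj := by
    intro ξ h ξ' h' n hn
    obtain ⟨h1, h2⟩ := h
    obtain ⟨g1, g2⟩ := h'
    rw [abs_lt] at h1 h2 g1 g2
    have key : ∀ i, -(π/2) < ξ i ∧ ξ i < π / 2 ∧ -(π/2) < ξ' i ∧ ξ' i < π / 2 := by
      rw [Fin.forall_fin_two]
      exact ⟨⟨h1.1, h1.2, g1.1, g1.2⟩, ⟨h2.1, h2.2, g2.1, g2.2⟩⟩
    ext i
    have := hn i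
    rw [LA2, LA2, diff_div] at this
    obtain ⟨k1, k2, k3, k4⟩ := key i
    obtain ⟨v1, v2⟩ := int_of_pi this (l := -1) (u := 1) (by push_cast; linarith) (by push_cast; linarith)
    have : n i = 0 := by omega
    simp_all
    linarith

def Ring2 (x y : ℝ) : Prop := (|x| ≤ π ∧ |y| ≤ π) ∧ (π / 2 ≤ |x| ∨ π / 2 ≤ |y|)

lemma Ring2_comm (x y : ℝ) : Ring2 x y ↔ Ring2 y x := by
  unfold Ring2; rw [and_comm (a := |x| ≤ π), or_comm]

lemma trap_m1 (x y : ℝ) : (Ring2 x y ∧ |y| ≤ |x| ∧ |x| ≤ 3 * |y| ∧ x * y ≤ 0) ↔ Trap (-1) x y := by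
  have hπ := Real.pi_pos
  constructor
  · rintro ⟨⟨⟨h1, h2⟩, h3⟩, h4, h5, h6⟩
    have hx : π / 2 ≤ |x| := by rcases h3 with h | h <;> linarith
    rcases le_total 0 x with sx | sx
    · rw [abs_of_nonneg sx] at *
      have sy : y ≤ 0 := by by_contra h; push Not at h; nlinarith
      rw [abs_of_nonpos sy] at *
      left; refine ⟨?_, ?_, ?_, ?_⟩ <;> push_cast <;> linarith
    · rw [abs_of_nonpos sx] at *
      have sy : 0 ≤ y := by by_contra h; push Not at h; nlinarith
      rw [abs_of_nonneg sy] at *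
      right; refine ⟨?_, ?_, ?_, ?_⟩ <;> push_cast <;> linarith
  · rintro (⟨h1, h2, h3, h4⟩ | ⟨h1, h2, h3, h4⟩) <;> push_cast at h3 h4
    · have sx : 0 ≤ x := by linarith
      have sy : y ≤ 0 := by linarith
      unfold Ring2
      rw [abs_of_nonneg sx, abs_of_nonpos sy]
      refine ⟨⟨⟨?_, ?_⟩, Or.inl h1⟩, ?_, ?_, mul_nonpos_of_nonneg_of_nonpos sx sy⟩ <;> linarith
    · have sx : x ≤ 0 := by linarith
      have sy : 0 ≤ y := by linarith
      unfold Ring2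
      rw [abs_of_nonpos sx, abs_of_nonneg sy]
      refine ⟨⟨⟨?_, ?_⟩, Or.inl h1⟩, ?_, ?_, mul_nonpos_of_nonpos_of_nonneg sx sy⟩ <;> linarith

lemma trap_p1 (x y : ℝ) : (Ring2 x y ∧ |y| ≤ |x| ∧ |x| ≤ 3 * |y| ∧ 0 ≤ x * y) ↔ Trap 1 x y := by
  have hπ := Real.pi_pos
  constructor
  · rintro ⟨⟨⟨h1, h2⟩, h3⟩, h4, h5, h6⟩
    have hx : π / 2 ≤ |x| := by rcases h3 with h | h <;> linarith
    rcases le_total 0 x with sx | sx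
    · rw [abs_of_nonneg sx] at *
      have sy : 0 ≤ y := by by_contra h; push Not at h; nlinarith
      rw [abs_of_nonneg sy] at *
      left; refine ⟨?_, ?_, ?_, ?_⟩ <;> push_cast <;> linarith
    · rw [abs_of_nonpos sx] at *
      have sy : y ≤ 0 := by by_contra h; push Not at h; nlinarith
      rw [abs_of_nonpos sy] at *
      right; refine ⟨?_, ?_, ?_, ?_⟩ <;> push_cast <;> linarith
  · rintro (⟨h1, h2, h3, h4⟩ | ⟨h1, h2, h3, h4⟩) <;> push_cast at h3 h4
    · have sx : 0 ≤ x := by linarith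
      have sy : 0 ≤ y := by linarith
      unfold Ring2
      rw [abs_of_nonneg sx, abs_of_nonneg sy]
      refine ⟨⟨⟨?_, ?_⟩, Or.inl h1⟩, ?_, ?_, mul_nonneg sx sy⟩ <;> linarith
    · have sx : x ≤ 0 := by linarith
      have sy : y ≤ 0 := by linarith
      unfold Ring2
      rw [abs_of_nonpos sx, abs_of_nonpos sy]
      refine ⟨⟨⟨?_, ?_⟩, Or.inl h1⟩, ?_, ?_, mul_nonneg_of_nonpos_of_nonpos sx sy⟩ <;> linarith

lemma trap_0 (x y : ℝ) : (Ring2 x y ∧ 3 * |y| ≤ |x|) ↔ Trap 0 x y := by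
  have hπ := Real.pi_pos
  constructor
  · rintro ⟨⟨⟨h1, h2⟩, h3⟩, h4⟩
    have hx : π / 2 ≤ |x| := by rcases h3 with h | h <;> linarith [abs_nonneg y]
    have hy1 := le_abs_self y
    have hy2 := neg_le_abs y
    rcases le_total 0 x with sx | sx
    · rw [abs_of_nonneg sx] at *
      left; refine ⟨?_, ?_, ?_, ?_⟩ <;> push_cast <;> linarith
    · rw [abs_of_nonpos sx] at *
      right; refine ⟨?_, ?_, ?_, ?_⟩ <;> push_cast <;> linarith
  · rintro (⟨h1, h2, h3, h4⟩ | ⟨h1, h2, h3, h4⟩) <;> push_cast at h3 h4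
    · have sx : 0 ≤ x := by linarith
      have sy : |y| ≤ x / 3 := abs_le.2 ⟨by linarith, by linarith⟩
      unfold Ring2
      rw [abs_of_nonneg sx]
      refine ⟨⟨⟨?_, ?_⟩, Or.inl h1⟩, ?_⟩ <;> linarith
    · have sx : x ≤ 0 := by linarith
      have sy : |y| ≤ -x / 3 := abs_le.2 ⟨by linarith, by linarith⟩
      unfold Ring2
      rw [abs_of_nonpos sx]
      refine ⟨⟨⟨?_, ?_⟩, Or.inl h1⟩, ?_⟩ <;> linarith

def UU : Fin 7 → Set V2 :=
  ![U0, UT 0 1 (-1), UT 0 1 0, UT 0 1 1, UT 1 0 (-1), UT 1 0 0, UT 1 0 1]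

lemma tp0 : trapPair 0 = E0 := rfl
lemma tp1 : trapPair 1 = ET 0 1 (-1) := Set.ext fun ξ => trap_m1 (ξ 0) (ξ 1)
lemma tp2 : trapPair 2 = ET 0 1 0 := Set.ext fun ξ => trap_0 (ξ 0) (ξ 1)
lemma tp3 : trapPair 3 = ET 0 1 1 := Set.ext fun ξ => trap_p1 (ξ 0) (ξ 1)
lemma tp4 : trapPair 4 = ET 1 0 (-1) := Set.ext fun ξ => by
  refine Iff.trans ?_ (trap_m1 (ξ 1) (ξ 0))
  rw [Ring2_comm, mul_comm (ξ 1) (ξ 0)]; rfl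
lemma tp5 : trapPair 5 = ET 1 0 0 := Set.ext fun ξ => by
  refine Iff.trans ?_ (trap_0 (ξ 1) (ξ 0))
  rw [Ring2_comm]; rfl
lemma tp6 : trapPair 6 = ET 1 0 1 := Set.ext fun ξ => by
  refine Iff.trans ?_ (trap_p1 (ξ 1) (ξ 0))
  rw [Ring2_comm, mul_comm (ξ 1) (ξ 0)]; rfl

lemma tiles_all (A : Fin 7 → Matrix (Fin 2) (Fin 2) ℝ) (hA0 : A 0 = A2)
    (hAj : ∀ j : Fin 7, j ≠ 0 → A j = QQ) (j : Fin 7) : Tiles (LA (A j)) (trapPair j) (UU j) := by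
  by_cases hj : j = 0
  · subst hj; rw [hA0]; exact tiles0
  · rw [hAj j hj]
    fin_cases j
    · exact absurd rfl hj
    · exact tp1 ▸ tiles01 (-1)
    · exact tp2 ▸ tiles01 0
    · exact tp3 ▸ tiles01 1
    · exact tp4 ▸ tiles10 (-1)
    · exact tp5 ▸ tiles10 0
    · exact tp6 ▸ tiles10 1

lemma UT_mem (p q : Fin 2) (k : ℤ) (ξ : V2) : ξ ∈ UT p q k ↔
  (π / 2 < ξ p ∧ ξ p < π ∧ (2 * k - 1) * ξ p < 3 * ξ q ∧ 3 * ξ q < (2 * k + 1) * ξ p) ∨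
  (π / 2 < -ξ p ∧ -ξ p < π ∧ (2 * k - 1) * (-ξ p) < -(3 * ξ q) ∧ -(3 * ξ q) < (2 * k + 1) * (-ξ p)) :=
  Iff.rfl

/-- The index of the piece to which a generic point belongs, in words: the pieces are disjoint. -/
lemma UU_disj (j k : Fin 7) (hjk : j < k) (ξ : V2) (hj : ξ ∈ UU j) (hk : ξ ∈ UU k) : False := by
  have h0 : ξ ∈ UU 0 ↔ (-(π / 2) < ξ 0 ∧ ξ 0 < π / 2) ∧ (-(π / 2) < ξ 1 ∧ ξ 1 < π / 2) := by
    change (|ξ 0| < π / 2 ∧ |ξ 1| < π / 2) ↔ _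
    rw [abs_lt, abs_lt]
  have h1 := UT_mem 0 1 (-1) ξ
  have h2 := UT_mem 0 1 0 ξ
  have h3 := UT_mem 0 1 1 ξ
  have h4 := UT_mem 1 0 (-1) ξ
  have h5 := UT_mem 1 0 0 ξ
  have h6 := UT_mem 1 0 1 ξ
  push_cast at h1 h2 h3 h4 h5 h6
  have hπ := Real.pi_pos
  have all : (j = 0 ∧ ξ ∈ UU 0) ∨ (j = 1 ∧ ξ ∈ UT 0 1 (-1)) ∨ (j = 2 ∧ ξ ∈ UT 0 1 0) ∨
      (j = 3 ∧ ξ ∈ UT 0 1 1) ∨ (j = 4 ∧ ξ ∈ UT 1 0 (-1)) ∨ (j = 5 ∧ ξ ∈ UT 1 0 0) ∨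
      (j = 6 ∧ ξ ∈ UT 1 0 1) := by
    fin_cases j
    · exact Or.inl ⟨rfl, hj⟩
    · exact Or.inr (Or.inl ⟨rfl, hj⟩)
    · exact Or.inr (Or.inr (Or.inl ⟨rfl, hj⟩))
    · exact Or.inr (Or.inr (Or.inr (Or.inl ⟨rfl, hj⟩)))
    · exact Or.inr (Or.inr (Or.inr (Or.inr (Or.inl ⟨rfl, hj⟩))))
    · exact Or.inr (Or.inr (Or.inr (Or.inr (Or.inr (Or.inl ⟨rfl, hj⟩)))))
    · exact Or.inr (Or.inr (Or.inr (Or.inr (Or.inr (Or.inr ⟨rfl, hj⟩)))))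
  have all' : (k = 0 ∧ ξ ∈ UU 0) ∨ (k = 1 ∧ ξ ∈ UT 0 1 (-1)) ∨ (k = 2 ∧ ξ ∈ UT 0 1 0) ∨
      (k = 3 ∧ ξ ∈ UT 0 1 1) ∨ (k = 4 ∧ ξ ∈ UT 1 0 (-1)) ∨ (k = 5 ∧ ξ ∈ UT 1 0 0) ∨
      (k = 6 ∧ ξ ∈ UT 1 0 1) := by
    fin_cases k
    · exact Or.inl ⟨rfl, hk⟩
    · exact Or.inr (Or.inl ⟨rfl, hk⟩)
    · exact Or.inr (Or.inr (Or.inl ⟨rfl, hk⟩))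
    · exact Or.inr (Or.inr (Or.inr (Or.inl ⟨rfl, hk⟩)))
    · exact Or.inr (Or.inr (Or.inr (Or.inr (Or.inl ⟨rfl, hk⟩))))
    · exact Or.inr (Or.inr (Or.inr (Or.inr (Or.inr (Or.inl ⟨rfl, hk⟩)))))
    · exact Or.inr (Or.inr (Or.inr (Or.inr (Or.inr (Or.inr ⟨rfl, hk⟩)))))
  rw [h0, h1, h2, h3, h4, h5, h6] at all all'
  clear h0 h1 h2 h3 h4 h5 h6 hj hk
  rcases all with ⟨e, h⟩ | ⟨e, h⟩ | ⟨e, h⟩ | ⟨e, h⟩ | ⟨e, h⟩ | ⟨e, h⟩ | ⟨e, h⟩ <;>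
  rcases all' with ⟨e', h'⟩ | ⟨e', h'⟩ | ⟨e', h'⟩ | ⟨e', h'⟩ | ⟨e', h'⟩ | ⟨e', h'⟩ | ⟨e', h'⟩ <;>
  subst e <;> subst e' <;>
  first
  | (exfalso; revert hjk; decide)
  | (obtain ⟨⟨_, _⟩, _, _⟩ := h
     rcases h' with ⟨_, _, _, _⟩ | ⟨_, _, _, _⟩ <;> linarith)
  | (rcases h with ⟨_, _, _, _⟩ | ⟨_, _, _, _⟩ <;>
     rcases h' with ⟨_, _, _, _⟩ | ⟨_, _, _, _⟩ <;> linarith)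

def sq : Set V2 := {ξ : Fin 2 → ℝ | |ξ 0| ≤ π ∧ |ξ 1| ≤ π}

lemma sq_meas : MeasurableSet sq := by
  unfold sq
  measurability

lemma trap_sub (j : Fin 7) : trapPair j ⊆ sq := by
  have hπ := Real.pi_pos
  fin_cases j
  · rintro ξ ⟨h1, h2⟩
    exact ⟨by linarith, by linarith⟩
  all_goals
    rintro ξ h
    exact h.1.1

lemma sq_sub (ξ : V2) (h : ξ ∈ sq) : ∃ j, ξ ∈ trapPair j := by
  by_cases h0 : |ξ 0| ≤ π / 2 ∧ |ξ 1| ≤ π / 2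
  · exact ⟨0, h0⟩
  have hr : ξ ∈ freqRing := by
    refine ⟨h, ?_⟩
    rw [not_and_or] at h0
    rcases h0 with h | h
    · exact Or.inl (not_le.1 h).le
    · exact Or.inr (not_le.1 h).le
  rcases le_total |ξ 1| |ξ 0| with h1 | h1
  · rcases le_total |ξ 0| (3 * |ξ 1|) with h2 | h2
    · rcases le_total (ξ 0 * ξ 1) 0 with h3 | h3
      · exact ⟨1, hr, h1, h2, h3⟩
      · exact ⟨3, hr, h1, h2, h3⟩
    · exact ⟨2, hr, h2⟩
  · rcases le_total |ξ 1| (3 * |ξ 0|) with h2 | h2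
    · rcases le_total (ξ 0 * ξ 1) 0 with h3 | h3
      · exact ⟨4, hr, h1, h2, h3⟩
      · exact ⟨6, hr, h1, h2, h3⟩
    · exact ⟨5, hr, h2⟩

end QS

set_option maxHeartbeats 1000000 in
/-- the Shannon-type quasi-shearlet family
`h_{j,n}(ξ) = (2π)⁻¹ |det A_j|^{1/2} e^{i (A_j n)·ξ} 𝟙_{E_j}(ξ)`,
with `A₀ = 2I₂` and `A_j = Q` for `j ≥ 1`, is an orthonormal basis of `L²([−π,π]²)`. -/
theorem stmt_13
    (A : Fin 7 → Matrix (Fin 2) (Fin 2) ℝ)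
    (hA0 : A 0 = Matrix.of ![![2, 0], ![0, 2]])
    (hAj : ∀ j : Fin 7, j ≠ 0 → A j = Matrix.of ![![2, 2], ![-2, 2]])
    (μ : Measure (Fin 2 → ℝ))
    (hμ : μ = volume.restrict {ξ : Fin 2 → ℝ | |ξ 0| ≤ π ∧ |ξ 1| ≤ π})
    (h : Fin 7 × (Fin 2 → ℤ) → Lp ℂ 2 μ)
    (hh : ∀ j : Fin 7, ∀ n : Fin 2 → ℤ,
      (h (j, n) : (Fin 2 → ℝ) → ℂ) =ᵐ[μ] fun ξ =>
        (((2 * π)⁻¹ * Real.sqrt |(A j).det| : ℝ) : ℂ) *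
          Complex.exp (Complex.I * ((A j).mulVec (fun i => (n i : ℝ)) ⬝ᵥ ξ : ℝ)) *
          Set.indicator (trapPair j) (fun _ => (1 : ℂ)) ξ) :
    Orthonormal ℂ h ∧ (Submodule.span ℂ (Set.range h)).topologicalClosure = ⊤ := by
  classical
  have T := QS.tiles_all A hA0 hAj
  set c : Fin 7 → ℝ := fun j => (2 * π)⁻¹ * Real.sqrt |(A j).det| with hc
  have hcdet : ∀ j, c j * c j = |LinearMap.det (QS.LA (A j))| := by
    intro j
    rw [QS.LA_det, abs_mul, abs_of_nonneg (by positivity : 0 ≤ ((2 * π)⁻¹) ^ 2)]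
    have := Real.mul_self_sqrt (abs_nonneg (A j).det)
    simp only [hc]
    linear_combination ((2 * π)⁻¹) ^ 2 * this
  have hc0 : ∀ j, c j ≠ 0 := by
    intro j h0
    have := hcdet j
    rw [h0, mul_zero] at this
    exact abs_ne_zero.2 (T j).det this.symm
  have hμE : ∀ j, μ.restrict (trapPair j) = volume.restrict (trapPair j) := by
    intro j
    rw [hμ, Measure.restrict_restrict (T j).mE]
    congr 1
    exact Set.inter_eq_left.2 (QS.trap_sub j)
  have hac : μ ≪ volume := by rw [hμ]; exact Measure.restrict_le_self.absolutelyContinuous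
  set F : Fin 7 → (Fin 2 → ℤ) → (Fin 2 → ℝ) → ℂ :=
    fun j n ξ => UnitAddTorus.mFourier n (QS.proj (QS.LA (A j)) ξ) with hF
  have hh' : ∀ j n, (h (j, n) : (Fin 2 → ℝ) → ℂ) =ᵐ[μ]
      (trapPair j).indicator (fun ξ => (c j : ℂ) * F j n ξ) := by
    intro j n
    filter_upwards [hh j n] with ξ hξ
    rw [hξ]
    have e : UnitAddTorus.mFourier n (QS.proj (QS.LA (A j)) ξ) =
        Complex.exp (Complex.I * ((A j).mulVec (fun i => (n i : ℝ)) ⬝ᵥ ξ : ℝ)) := by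
      rw [QS.four_eq]
      congr 3
      rw [QS.LA_apply, QS.LA_apply]
      have := Real.pi_pos
      simp only [Matrix.mulVec, dotProduct, Fin.sum_univ_two]
      field_simp
      ring
    by_cases hm : ξ ∈ trapPair j
    · rw [Set.indicator_of_mem hm, Set.indicator_of_mem hm, mul_one, hF]
      simp only
      rw [e]
    · rw [Set.indicator_of_notMem hm, Set.indicator_of_notMem hm, mul_zero]
  have hU : ∀ j, ∀ᵐ ξ ∂μ, ξ ∈ trapPair j → ξ ∈ QS.UU j := by
    intro j
    apply hac.ae_le
    have := (T j).null
    rw [measure_eq_zero_iff_ae_notMem] at this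
    filter_upwards [this] with ξ h1 h2
    by_contra h3
    exact h1 ⟨h2, h3⟩
  have hinner : ∀ j n (f : Lp ℂ 2 μ), inner ℂ (h (j, n)) f =
      (c j : ℂ) * ∫ ξ in trapPair j, starRingEnd ℂ (F j n ξ) * f ξ := by
    intro j n f
    rw [L2.inner_def, ← integral_const_mul, ← hμE j, ← integral_indicator (T j).mE]
    apply integral_congr_ae
    filter_upwards [hh' j n] with ξ h1
    rw [h1]
    by_cases hm : ξ ∈ trapPair j
    · rw [Set.indicator_of_mem hm, Set.indicator_of_mem hm, RCLike.inner_apply, map_mul,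
        Complex.conj_ofReal]
      ring
    · rw [Set.indicator_of_notMem hm, Set.indicator_of_notMem hm, inner_zero_left]
  constructor
  · rw [orthonormal_iff_ite]
    rintro ⟨j, n⟩ ⟨k, m⟩
    rw [hinner]
    by_cases hjk : j = k
    · subst hjk
      have h1 : ∫ ξ in trapPair j, starRingEnd ℂ (F j n ξ) * (h (j, m) : (Fin 2 → ℝ) → ℂ) ξ
          = ∫ ξ in trapPair j, (c j : ℂ) * UnitAddTorus.mFourier (-n + m) (QS.proj (QS.LA (A j)) ξ) := by
        rw [← hμE j]
        apply integral_congr_ae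
        filter_upwards [ae_restrict_of_ae (hh' j m), ae_restrict_mem (T j).mE] with ξ h1 h2
        rw [h1, Set.indicator_of_mem h2, UnitAddTorus.mFourier_add, UnitAddTorus.mFourier_neg]
        simp only [hF]
        ring
      rw [h1, integral_const_mul, (T j).integral_four, ← hcdet j]
      have e : -n + m = 0 ↔ (j, n) = (j, m) := by
        rw [neg_add_eq_zero]; simp
      simp only [e]
      have hcj : (c j : ℂ) ≠ 0 := by exact_mod_cast hc0 j
      split_ifs
      · push_cast; field_simp
      · simp
    · have h1 : ∫ ξ in trapPair j, starRingEnd ℂ (F j n ξ) * (h (k, m) : (Fin 2 → ℝ) → ℂ) ξ = 0 := by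
        rw [← hμE j]
        apply integral_eq_zero_of_ae
        filter_upwards [ae_restrict_of_ae (hh' k m), ae_restrict_mem (T j).mE,
          ae_restrict_of_ae (hU j), ae_restrict_of_ae (hU k)] with ξ h1 h2 h3 h4
        have : ξ ∉ trapPair k := by
          intro h5
          rcases lt_or_gt_of_ne hjk with h | h
          · exact QS.UU_disj j k h ξ (h3 h2) (h4 h5)
          · exact QS.UU_disj k j h ξ (h4 h5) (h3 h2)
        rw [h1, Set.indicator_of_notMem this, mul_zero]
        rfl
      rw [h1, mul_zero, if_neg]
      exact fun e => hjk (congrArg Prod.fst e)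
  · rw [Submodule.topologicalClosure_eq_top_iff, Submodule.eq_bot_iff]
    intro f hf
    rw [Submodule.mem_orthogonal] at hf
    have hz : ∀ j, (f : (Fin 2 → ℝ) → ℂ) =ᵐ[volume.restrict (trapPair j)] 0 := by
      intro j
      apply (T j).zero
      · rw [← hμE j]
        exact (Lp.memLp f).restrict _
      · intro n
        have h1 := hf (h (j, n)) (Submodule.subset_span ⟨_, rfl⟩)
        rw [hinner, mul_eq_zero] at h1
        rcases h1 with h1 | h1
        · exact absurd (by exact_mod_cast h1) (hc0 j)
        · exact h1
    rw [Lp.eq_zero_iff_ae_eq_zero]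
    have hz' : ∀ j, ∀ᵐ ξ ∂μ, ξ ∈ trapPair j → (f : (Fin 2 → ℝ) → ℂ) ξ = 0 := by
      intro j
      rw [← ae_restrict_iff' (T j).mE, hμE j]
      exact hz j
    have hsq : ∀ᵐ ξ ∂μ, ξ ∈ QS.sq := by
      rw [hμ]
      exact ae_restrict_mem QS.sq_meas
    filter_upwards [ae_all_iff.2 hz', hsq] with ξ h1 h2
    obtain ⟨j, hj⟩ := QS.sq_sub ξ h2
    exact h1 j hj
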